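/- arXiv:1003.0297 — 2 statements merged into one kernel-verified Lean document; each statement's English description precedes it below -/
import Mathlib

section
/- Let n ≥ 2, 0 ≤ r < 1, and let σ = {λ₁,…,λ_m} be a finite sequence in 𝔻 with 1 ≤ m ≤ n and |λ_j| ≤ r for all j. Then the operator norm of differentiation D : K_{B_σ} → H² satisfies ‖D‖ ≤ (n/(1-r))·(1 + r + 1/√n). -/
open Complex Filter Finset MeasureTheory Metric

noncomputable section

/-- The `k`-th Taylor coefficient of `f` at `0`. -/
def hcoeff (f : ℂ → ℂ) (k : ℕ) : ℂ := iteratedDeriv k f 0 / (Nat.factorial k : ℂ)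

/-- The Hardy space `H²` norm of `f`, computed through the Taylor coefficients at `0`:
`‖f‖₂² = ∑_{k≥0} |f̂(k)|²`. -/
def h2norm (f : ℂ → ℂ) : ℝ := Real.sqrt (∑' k : ℕ, ‖hcoeff f k‖ ^ 2)

/-- Membership in the Hardy space `H²` of the unit disc: `f` is holomorphic on the unit
disc and its Taylor coefficients are square-summable. -/
def MemH2 (f : ℂ → ℂ) : Prop :=
  DifferentiableOn ℂ f (ball 0 1) ∧ Summable (fun k : ℕ => ‖hcoeff f k‖ ^ 2)

/-- The `H²` inner product `(f,g) = ∑_{k≥0} f̂(k)·conj(ĝ(k))`. -/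
def h2inner (f g : ℂ → ℂ) : ℂ := ∑' k : ℕ, hcoeff f k * (starRingEnd ℂ) (hcoeff g k)

/-- Elementary Blaschke factor `b_λ(z) = (λ - z)/(1 - conj(λ)·z)`. -/
def blaschke (l : ℂ) : ℂ → ℂ := fun z => (l - z) / (1 - (starRingEnd ℂ) l * z)

/-- Membership in the model space `K_B = H² ⊖ B·H²`: `f ∈ H²` and `f` is orthogonal to
`B·g` for every `g ∈ H²`. -/
def MemKB (B f : ℂ → ℂ) : Prop :=
  MemH2 f ∧ ∀ g : ℂ → ℂ, MemH2 g → h2inner f (fun z => B z * g z) = 0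

/-- The norm of the differentiation operator `D : K_B → H²`, `Df = f'`. -/
def DNorm (B : ℂ → ℂ) : ℝ :=
  sSup {x : ℝ | ∃ f : ℂ → ℂ, MemKB B f ∧ h2norm f ≤ 1 ∧ x = h2norm (deriv f)}

/-- `C_{n,r}`: the supremum of `‖D‖_{K_{B_σ} → H²}` over all finite sequences `σ` in the
unit disc with `1 ≤ card σ ≤ n` and `|λ| ≤ r` for all `λ ∈ σ`. -/
def Cnr (n : ℕ) (r : ℝ) : ℝ :=
  sSup {x : ℝ | ∃ m : ℕ, 1 ≤ m ∧ m ≤ n ∧ ∃ l : Fin m → ℂ,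
    (∀ j, ‖l j‖ ≤ r) ∧ x = DNorm (fun z => ∏ j, blaschke (l j) z)}

/-- The Malmquist–Walsh basis function `e_k(z) = (1-r²)^{1/2}/(1-rz) · b_r(z)^{k-1}`
of the model space `K_{b_r^n}`. -/
def mw (r : ℝ) (k : ℕ) : ℂ → ℂ :=
  fun z => (Real.sqrt (1 - r ^ 2) : ℂ) / (1 - (r : ℂ) * z) * (blaschke (r : ℂ) z) ^ (k - 1)

open scoped InnerProductSpace

/-- The sequence space `ℓ²`, the coefficient model of `H²`. -/
abbrev SeqH2 : Type := lp (fun _ : ℕ => ℂ) 2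

/-- A sequence with square-summable moduli as an element of `ℓ²`. -/
def SeqH2.mk (a : ℕ → ℂ) (ha : Summable fun k => ‖a k‖ ^ 2) : SeqH2 :=
  ⟨a, memℓp_gen (by simpa using ha)⟩

lemma SeqH2.mk_apply (a : ℕ → ℂ) (ha : Summable fun k => ‖a k‖ ^ 2) (k : ℕ) :
    SeqH2.mk a ha k = a k := rfl

lemma SeqH2.add_apply (x y : SeqH2) (k : ℕ) : (x + y) k = x k + y k := rfl

lemma SeqH2.sub_apply (x y : SeqH2) (k : ℕ) : (x - y) k = x k - y k := rfl

lemma SeqH2.smul_apply (c : ℂ) (x : SeqH2) (k : ℕ) : (c • x) k = c * x k := rfl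

lemma SeqH2.hasSum_norm_sq (x : SeqH2) : HasSum (fun k => ‖x k‖ ^ 2) (‖x‖ ^ 2) := by
  simpa using lp.hasSum_norm (p := 2) (by norm_num) x

/-- The coefficient sequence of `z * f`, when `a` is the coefficient sequence of `f`. -/
def shiftSeq (a : ℕ → ℂ) : ℕ → ℂ
  | 0 => 0
  | k + 1 => a k

lemma hasSum_shiftSeq_norm_sq (x : SeqH2) :
    HasSum (fun k => ‖shiftSeq x k‖ ^ 2) (‖x‖ ^ 2) := by
  rw [← hasSum_nat_add_iff' 1]
  simpa [shiftSeq] using x.hasSum_norm_sq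

/-- The unilateral shift on `ℓ²`. -/
def shift : SeqH2 →ₗᵢ[ℂ] SeqH2 where
  toFun x := SeqH2.mk (shiftSeq x) (hasSum_shiftSeq_norm_sq x).summable
  map_add' x y := by
    ext k
    cases k <;> simp [SeqH2.mk_apply, shiftSeq]
  map_smul' c x := by
    ext k
    cases k <;> simp [SeqH2.mk_apply, shiftSeq]
  norm_map' x := by
    have h := (SeqH2.hasSum_norm_sq (SeqH2.mk _ (hasSum_shiftSeq_norm_sq x).summable)).unique
      (hasSum_shiftSeq_norm_sq x)
    exact (sq_eq_sq₀ (norm_nonneg _) (norm_nonneg _)).1 h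

@[simp] lemma shift_apply_zero (x : SeqH2) : shift x 0 = 0 := rfl

@[simp] lemma shift_apply_succ (x : SeqH2) (k : ℕ) : shift x (k + 1) = x k := rfl

/-- The operator `1 - μ S`, with `S` the shift. -/
def oneSubShift (μ : ℂ) : SeqH2 →L[ℂ] SeqH2 := 1 - μ • shift.toContinuousLinearMap

lemma oneSubShift_apply (μ : ℂ) (x : SeqH2) : oneSubShift μ x = x - μ • shift x := rfl

lemma isUnit_oneSubShift {μ : ℂ} (hμ : ‖μ‖ < 1) : IsUnit (oneSubShift μ) := by
  refine isUnit_one_sub_of_norm_lt_one (lt_of_le_of_lt ?_ hμ)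
  rw [norm_smul]
  exact mul_le_of_le_one_right (norm_nonneg _) shift.norm_toContinuousLinearMap_le

/-- Multiplication by `1 / (1 - μ z)` on coefficient sequences. -/
def shiftResolvent (μ : ℂ) : SeqH2 →L[ℂ] SeqH2 := Ring.inverse (oneSubShift μ)

lemma oneSubShift_shiftResolvent {μ : ℂ} (hμ : ‖μ‖ < 1) (x : SeqH2) :
    oneSubShift μ (shiftResolvent μ x) = x :=
  DFunLike.congr_fun (Ring.mul_inverse_cancel _ (isUnit_oneSubShift hμ)) x

lemma shiftResolvent_oneSubShift {μ : ℂ} (hμ : ‖μ‖ < 1) (x : SeqH2) :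
    shiftResolvent μ (oneSubShift μ x) = x :=
  DFunLike.congr_fun (Ring.inverse_mul_cancel _ (isUnit_oneSubShift hμ)) x

lemma shiftResolvent_eq {μ : ℂ} (hμ : ‖μ‖ < 1) (x : SeqH2) :
    shiftResolvent μ x = x + μ • shift (shiftResolvent μ x) := by
  have h := oneSubShift_shiftResolvent hμ x
  rw [oneSubShift_apply, sub_eq_iff_eq_add] at h
  exact h

lemma shiftResolvent_apply_zero {μ : ℂ} (hμ : ‖μ‖ < 1) (x : SeqH2) :
    shiftResolvent μ x 0 = x 0 := by
  conv_lhs => rw [shiftResolvent_eq hμ]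
  simp [SeqH2.add_apply, SeqH2.smul_apply, -lp.coeFn_add, -lp.coeFn_smul]

lemma shiftResolvent_apply_succ {μ : ℂ} (hμ : ‖μ‖ < 1) (x : SeqH2) (k : ℕ) :
    shiftResolvent μ x (k + 1) = x (k + 1) + μ * shiftResolvent μ x k := by
  conv_lhs => rw [shiftResolvent_eq hμ]
  simp [SeqH2.add_apply, SeqH2.smul_apply, -lp.coeFn_add, -lp.coeFn_smul]

lemma norm_shiftResolvent_le {μ : ℂ} (hμ : ‖μ‖ < 1) (x : SeqH2) :
    ‖shiftResolvent μ x‖ ≤ ‖x‖ / (1 - ‖μ‖) := by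
  have h : ‖shiftResolvent μ x‖ ≤ ‖x‖ + ‖μ‖ * ‖shiftResolvent μ x‖ := by
    conv_lhs => rw [shiftResolvent_eq hμ]
    refine (norm_add_le _ _).trans ?_
    rw [norm_smul, shift.norm_map]
  rw [le_div_iff₀ (by linarith)]
  linarith

/-- Multiplication by the Blaschke factor `b_λ` on coefficient sequences. -/
def blaschkeOp (l : ℂ) : SeqH2 →L[ℂ] SeqH2 :=
  (l • 1 - shift.toContinuousLinearMap) * shiftResolvent ((starRingEnd ℂ) l)

lemma blaschkeOp_apply (l : ℂ) (x : SeqH2) :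
    blaschkeOp l x = l • shiftResolvent ((starRingEnd ℂ) l) x -
      shift (shiftResolvent ((starRingEnd ℂ) l) x) := rfl

lemma norm_conj_lt_one {l : ℂ} (hl : ‖l‖ < 1) : ‖(starRingEnd ℂ) l‖ < 1 := by
  rwa [RCLike.norm_conj]

lemma norm_smul_sub_shift (l : ℂ) (x : SeqH2) :
    ‖l • x - shift x‖ = ‖oneSubShift ((starRingEnd ℂ) l) x‖ := by
  rw [← sq_eq_sq₀ (norm_nonneg _) (norm_nonneg _), oneSubShift_apply,
    norm_sub_sq (𝕜 := ℂ), norm_sub_sq (𝕜 := ℂ)]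
  simp only [norm_smul, shift.norm_map, inner_smul_left, inner_smul_right, RCLike.norm_conj]
  ring

lemma norm_blaschkeOp {l : ℂ} (hl : ‖l‖ < 1) (x : SeqH2) : ‖blaschkeOp l x‖ = ‖x‖ := by
  rw [blaschkeOp_apply, norm_smul_sub_shift, oneSubShift_shiftResolvent (norm_conj_lt_one hl)]

lemma blaschkeOp_oneSubShift {l : ℂ} (hl : ‖l‖ < 1) (x : SeqH2) :
    blaschkeOp l (oneSubShift ((starRingEnd ℂ) l) x) = l • x - shift x := by
  rw [blaschkeOp_apply, shiftResolvent_oneSubShift (norm_conj_lt_one hl)]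

/-- A sequence orthogonal to the range of multiplication by `b_λ` is geometric. -/
lemma apply_succ_of_forall_inner_blaschkeOp_eq_zero {l : ℂ} (hl : ‖l‖ < 1) {h : SeqH2}
    (hh : ∀ x, ⟪blaschkeOp l x, h⟫_ℂ = 0) (k : ℕ) : h (k + 1) = (starRingEnd ℂ) l * h k := by
  have hs : shift (lp.single 2 k (1 : ℂ)) = lp.single 2 (k + 1) (1 : ℂ) := by
    ext j
    cases j with
    | zero => simp
    | succ j => simp [Pi.single_apply]
  have h0 := hh (oneSubShift ((starRingEnd ℂ) l) (lp.single 2 k (1 : ℂ)))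
  rw [blaschkeOp_oneSubShift hl, hs, inner_sub_left, inner_smul_left, lp.inner_single_left,
    lp.inner_single_left] at h0
  simpa [sub_eq_zero, eq_comm (a := h (k + 1))] using h0

/-- `a'` is the coefficient sequence of the derivative of the function with coefficients `a`. -/
def IsSeqDeriv (a a' : SeqH2) : Prop := ∀ k : ℕ, a' k = (k + 1) * a (k + 1)

lemma IsSeqDeriv.add {a a' b b' : SeqH2} (ha : IsSeqDeriv a a') (hb : IsSeqDeriv b b') :
    IsSeqDeriv (a + b) (a' + b') := by
  intro k
  simp only [SeqH2.add_apply, ha k, hb k]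
  ring

lemma IsSeqDeriv.sub {a a' b b' : SeqH2} (ha : IsSeqDeriv a a') (hb : IsSeqDeriv b b') :
    IsSeqDeriv (a - b) (a' - b') := by
  intro k
  simp only [SeqH2.sub_apply, ha k, hb k]
  ring

lemma IsSeqDeriv.smul {a a' : SeqH2} (c : ℂ) (ha : IsSeqDeriv a a') :
    IsSeqDeriv (c • a) (c • a') := by
  intro k
  simp only [SeqH2.smul_apply, ha k]
  ring

lemma IsSeqDeriv.map_shift {a a' : SeqH2} (ha : IsSeqDeriv a a') :
    IsSeqDeriv (shift a) (a + shift a') := by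
  intro k
  cases k with
  | zero => simp
  | succ k =>
    simp only [SeqH2.add_apply, shift_apply_succ, ha k]
    push_cast
    ring

lemma IsSeqDeriv.map_shiftResolvent {μ : ℂ} (hμ : ‖μ‖ < 1) {a a' : SeqH2} (ha : IsSeqDeriv a a') :
    IsSeqDeriv (shiftResolvent μ a)
      (shiftResolvent μ (a' + μ • shiftResolvent μ a)) := by
  intro k
  induction k with
  | zero =>
    rw [shiftResolvent_apply_zero hμ, shiftResolvent_apply_succ hμ]
    simp [SeqH2.add_apply, SeqH2.smul_apply, -lp.coeFn_add, -lp.coeFn_smul, ha 0,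
      shiftResolvent_apply_zero hμ]
  | succ k ih =>
    rw [shiftResolvent_apply_succ hμ, ih, shiftResolvent_apply_succ hμ a (k + 1)]
    simp only [SeqH2.add_apply, SeqH2.smul_apply, ha (k + 1)]
    push_cast
    ring

lemma IsSeqDeriv.map_blaschkeOp {l : ℂ} (hl : ‖l‖ < 1) {a a' : SeqH2} (ha : IsSeqDeriv a a') :
    IsSeqDeriv (blaschkeOp l a) (blaschkeOp l a' - ((1 - ‖l‖ ^ 2 : ℝ) : ℂ) •
      shiftResolvent ((starRingEnd ℂ) l) (shiftResolvent ((starRingEnd ℂ) l) a)) := by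
  have hμ := norm_conj_lt_one hl
  have hw := ha.map_shiftResolvent hμ
  have hll : ((1 - ‖l‖ ^ 2 : ℝ) : ℂ) = 1 - l * (starRingEnd ℂ) l := by
    rw [Complex.mul_conj, Complex.normSq_eq_norm_sq]
    push_cast
    rfl
  rw [blaschkeOp_apply l a]
  set w := shiftResolvent ((starRingEnd ℂ) l) a
  convert (hw.smul l).sub hw.map_shift using 1
  have hv := shiftResolvent_eq hμ w
  rw [map_add, map_smul, blaschkeOp_apply, map_add, map_smul, hll]
  generalize shiftResolvent ((starRingEnd ℂ) l) w = v at *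
  rw [eq_sub_of_add_eq hv.symm]
  module

lemma isSeqDeriv_of_apply_succ {μ : ℂ} (hμ : ‖μ‖ < 1) {h : SeqH2}
    (hh : ∀ k, h (k + 1) = μ * h k) : IsSeqDeriv h (μ • shiftResolvent μ h) := by
  intro k
  induction k with
  | zero => simp [shiftResolvent_apply_zero hμ, hh]
  | succ k ih =>
    simp only [SeqH2.smul_apply] at ih ⊢
    rw [shiftResolvent_apply_succ hμ, ih, hh (k + 1)]
    push_cast
    ring

lemma exists_isSeqDeriv_norm_le {r : ℝ} (hr : r < 1) (L : List ℂ) (hL : ∀ l ∈ L, ‖l‖ ≤ r)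
    (a : SeqH2) (ha : ∀ x, ⟪(L.map blaschkeOp).prod x, a⟫_ℂ = 0) :
    ∃ a', IsSeqDeriv a a' ∧
      ‖a'‖ ≤ (L.length * ((1 + r) / (1 - r)) + √L.length * (1 / (1 - r))) * ‖a‖ := by
  induction L generalizing a with
  | nil =>
    have h0 : a = 0 := by simpa using ha a
    exact ⟨0, by simp [IsSeqDeriv, h0], by simp⟩
  | cons l L ih =>
    have hlr : ‖l‖ ≤ r := hL l (by simp)
    have hl : ‖l‖ < 1 := hlr.trans_lt hr
    have hμ := norm_conj_lt_one hl
    set V := blaschkeOp l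
    set g := ContinuousLinearMap.adjoint V a with hg
    obtain ⟨g', hg', hgn⟩ := ih (fun l' h' => hL l' (by simp [h'])) g fun x => by
      rw [hg, ContinuousLinearMap.adjoint_inner_right]
      simpa using ha x
    have hVi : ∀ x y, ⟪V x, V y⟫_ℂ = ⟪x, y⟫_ℂ :=
      LinearIsometry.inner_map_map ⟨V.toLinearMap, norm_blaschkeOp hl⟩
    set h := a - V g with hh
    have horth : ∀ x, ⟪V x, h⟫_ℂ = 0 := fun x => by
      rw [hh, inner_sub_right, hVi, hg, ContinuousLinearMap.adjoint_inner_right, sub_self]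
    have hdh := isSeqDeriv_of_apply_succ hμ
      (apply_succ_of_forall_inner_blaschkeOp_eq_zero hl horth)
    have hsum : a = h + V g := by rw [hh, sub_add_cancel]
    have hpyth : ‖a‖ ^ 2 = ‖h‖ ^ 2 + ‖g‖ ^ 2 := by
      rw [hsum, norm_add_sq (𝕜 := ℂ), inner_eq_zero_symm.1 (horth g), norm_blaschkeOp hl]
      simp
    refine ⟨_, hsum ▸ hdh.add (hg'.map_blaschkeOp hl), ?_⟩
    have h1r : 0 < 1 - r := by linarith
    have h1l : 0 < 1 - ‖l‖ := by linarith
    have e1 : ‖(starRingEnd ℂ) l • shiftResolvent ((starRingEnd ℂ) l) h‖ ≤ 1 / (1 - r) * ‖h‖ := by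
      rw [norm_smul, RCLike.norm_conj]
      have := norm_shiftResolvent_le hμ h
      rw [RCLike.norm_conj] at this
      calc _ ≤ 1 * (‖h‖ / (1 - ‖l‖)) := by gcongr
        _ ≤ 1 * (‖h‖ / (1 - r)) := by gcongr
        _ = _ := by ring
    have e2 : ‖((1 - ‖l‖ ^ 2 : ℝ) : ℂ) • shiftResolvent ((starRingEnd ℂ) l)
        (shiftResolvent ((starRingEnd ℂ) l) g)‖ ≤ (1 + r) / (1 - r) * ‖g‖ := by
      have h0 : 0 ≤ 1 - ‖l‖ ^ 2 := by nlinarith [norm_nonneg l]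
      rw [norm_smul, Complex.norm_of_nonneg h0]
      have s1 := norm_shiftResolvent_le hμ g
      have s2 := norm_shiftResolvent_le hμ (shiftResolvent ((starRingEnd ℂ) l) g)
      rw [RCLike.norm_conj] at s1 s2
      calc _ ≤ (1 - ‖l‖ ^ 2) * (‖g‖ / (1 - ‖l‖) / (1 - ‖l‖)) := by
            gcongr
            exact s2.trans (by gcongr)
        _ = (1 + ‖l‖) / (1 - ‖l‖) * ‖g‖ := by field_simp; ring
        _ ≤ _ := by
            gcongr
            linarith [norm_nonneg l]
    have hga : ‖g‖ ≤ ‖a‖ := by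
      refine (sq_le_sq₀ (norm_nonneg _) (norm_nonneg _)).1 ?_
      nlinarith [sq_nonneg ‖h‖]
    have hcs : ‖h‖ + √L.length * ‖g‖ ≤ √(L.length + 1) * ‖a‖ := by
      refine abs_le_of_sq_le_sq' ?_ (by positivity) |>.2
      rw [mul_pow, Real.sq_sqrt (by positivity), hpyth]
      have := Real.sq_sqrt (Nat.cast_nonneg (α := ℝ) L.length)
      nlinarith [sq_nonneg (√L.length * ‖h‖ - ‖g‖)]
    have hr0 : 0 ≤ r := (norm_nonneg l).trans hlr
    calc _ ≤ 1 / (1 - r) * ‖h‖ + (‖g'‖ + (1 + r) / (1 - r) * ‖g‖) := by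
          refine (norm_add_le _ _).trans (add_le_add e1 ((norm_sub_le _ _).trans ?_))
          rw [norm_blaschkeOp hl]
          gcongr
      _ ≤ 1 / (1 - r) * ‖h‖ + ((L.length * ((1 + r) / (1 - r)) + √L.length * (1 / (1 - r))) * ‖g‖
            + (1 + r) / (1 - r) * ‖g‖) := by gcongr
      _ = (L.length + 1) * ((1 + r) / (1 - r)) * ‖g‖ +
            1 / (1 - r) * (‖h‖ + √L.length * ‖g‖) := by ring
      _ ≤ (L.length + 1) * ((1 + r) / (1 - r)) * ‖a‖ +
            1 / (1 - r) * (√(L.length + 1) * ‖a‖) := by gcongr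
      _ = _ := by
          push_cast [List.length_cons]
          ring

/-- The function on the disc with coefficient sequence `x`. -/
def seqEval (x : SeqH2) (z : ℂ) : ℂ := ∑' k, x k * z ^ k

lemma summable_seqEval (x : SeqH2) {z : ℂ} (hz : ‖z‖ < 1) : Summable fun k => x k * z ^ k := by
  refine Summable.of_norm_bounded (g := fun k => ‖x‖ * ‖z‖ ^ k)
    ((summable_geometric_of_lt_one (norm_nonneg z) hz).mul_left _) fun k => ?_
  rw [norm_mul, norm_pow]
  gcongr
  exact lp.norm_apply_le_norm (by norm_num) x k

lemma seqEval_smul_sub (c d : ℂ) (x y : SeqH2) {z : ℂ} (hz : ‖z‖ < 1) :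
    seqEval (c • x - d • y) z = c * seqEval x z - d * seqEval y z := by
  simp only [seqEval]
  rw [← tsum_mul_left, ← tsum_mul_left, ← ((summable_seqEval x hz).mul_left c).tsum_sub
    ((summable_seqEval y hz).mul_left d)]
  refine tsum_congr fun k => ?_
  simp only [SeqH2.sub_apply, SeqH2.smul_apply]
  ring

lemma seqEval_shift (x : SeqH2) {z : ℂ} (hz : ‖z‖ < 1) :
    seqEval (shift x) z = z * seqEval x z := by
  simp only [seqEval]
  rw [(summable_seqEval (shift x) hz).tsum_eq_zero_add, ← tsum_mul_left]
  simp only [shift_apply_zero, shift_apply_succ, zero_mul, zero_add]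
  exact tsum_congr fun k => by ring

lemma seqEval_blaschkeOp {l : ℂ} (hl : ‖l‖ < 1) (x : SeqH2) {z : ℂ} (hz : ‖z‖ < 1) :
    seqEval (blaschkeOp l x) z = blaschke l z * seqEval x z := by
  have hμ := norm_conj_lt_one hl
  have h1 : seqEval (blaschkeOp l x) z =
      (l - z) * seqEval (shiftResolvent ((starRingEnd ℂ) l) x) z := by
    have := seqEval_smul_sub l 1 (shiftResolvent ((starRingEnd ℂ) l) x)
      (shift (shiftResolvent ((starRingEnd ℂ) l) x)) hz
    rw [seqEval_shift _ hz, one_smul] at this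
    rw [blaschkeOp_apply, this]
    ring
  have h2 : seqEval x z = (1 - (starRingEnd ℂ) l * z) *
      seqEval (shiftResolvent ((starRingEnd ℂ) l) x) z := by
    have := seqEval_smul_sub 1 ((starRingEnd ℂ) l) (shiftResolvent ((starRingEnd ℂ) l) x)
      (shift (shiftResolvent ((starRingEnd ℂ) l) x)) hz
    rw [seqEval_shift _ hz, one_smul, ← oneSubShift_apply, oneSubShift_shiftResolvent hμ] at this
    rw [this]
    ring
  have hne : 1 - (starRingEnd ℂ) l * z ≠ 0 := by
    intro h
    have : ‖(starRingEnd ℂ) l * z‖ = 1 := by rw [← sub_eq_zero.1 h, norm_one]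
    rw [norm_mul] at this
    nlinarith [norm_nonneg z, norm_nonneg ((starRingEnd ℂ) l)]
  rw [h1, h2, blaschke, ← mul_assoc, div_mul_cancel₀ _ hne]

lemma seqEval_prod_blaschkeOp (L : List ℂ) (hL : ∀ l ∈ L, ‖l‖ < 1) (x : SeqH2) {z : ℂ}
    (hz : ‖z‖ < 1) : seqEval ((L.map blaschkeOp).prod x) z =
      (L.map fun l => blaschke l z).prod * seqEval x z := by
  induction L with
  | nil => simp
  | cons l L ih =>
    simp only [List.map_cons, List.prod_cons]
    change seqEval (blaschkeOp l ((L.map blaschkeOp).prod x)) z = _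
    rw [seqEval_blaschkeOp (hL l (by simp)) _ hz, ih fun l' h' => hL l' (by simp [h']), mul_assoc]

lemma hasFPowerSeriesOnBall_seqEval (x : SeqH2) :
    HasFPowerSeriesOnBall (seqEval x) (FormalMultilinearSeries.ofScalars ℂ (x : ℕ → ℂ)) 0 1 := by
  refine ⟨?_, one_pos, fun {z} hz => ?_⟩
  · refine ENNReal.le_of_forall_nnreal_lt fun s hs => ?_
    refine FormalMultilinearSeries.le_radius_of_bound _ ‖x‖ fun k => ?_
    have hs1 : (s : ℝ) ≤ 1 := by exact_mod_cast hs.le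
    rw [FormalMultilinearSeries.ofScalars_norm]
    exact (mul_le_of_le_one_right (norm_nonneg _) (pow_le_one₀ s.2 hs1)).trans
      (lp.norm_apply_le_norm (by norm_num) x k)
  · have hz1 : ‖z‖ < 1 := by simpa [← NNReal.coe_lt_coe, enorm_eq_nnnorm] using hz
    simpa [FormalMultilinearSeries.ofScalars_apply_eq, seqEval, mul_comm] using
      (summable_seqEval x hz1).hasSum

lemma hcoeff_seqEval (x : SeqH2) (k : ℕ) : hcoeff (seqEval x) k = x k := by
  have h := (hasFPowerSeriesOnBall_seqEval x).hasFPowerSeriesAt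
  have h2 := h.analyticAt.hasFPowerSeriesAt
  have h3 := congrArg (fun p => FormalMultilinearSeries.coeff p k) (h2.eq_formalMultilinearSeries h)
  simpa [hcoeff, FormalMultilinearSeries.coeff_ofScalars] using h3

lemma memH2_seqEval (x : SeqH2) : MemH2 (seqEval x) := by
  refine ⟨?_, by simpa only [hcoeff_seqEval] using x.hasSum_norm_sq.summable⟩
  have := (hasFPowerSeriesOnBall_seqEval x).differentiableOn
  rwa [← ENNReal.ofReal_one, Metric.eball_ofReal] at this

lemma hcoeff_congr {f g : ℂ → ℂ} (h : Set.EqOn f g (ball 0 1)) (k : ℕ) :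
    hcoeff f k = hcoeff g k := by
  rw [hcoeff, hcoeff, (h.eventuallyEq_of_mem (ball_mem_nhds 0 one_pos)).iteratedDeriv_eq]

lemma hcoeff_deriv (f : ℂ → ℂ) (k : ℕ) : hcoeff (deriv f) k = (k + 1) * hcoeff f (k + 1) := by
  have h1 : ((k : ℂ) + 1) ≠ 0 := by exact_mod_cast k.succ_ne_zero
  have h2 : (k.factorial : ℂ) ≠ 0 := by exact_mod_cast k.factorial_ne_zero
  rw [hcoeff, hcoeff, ← iteratedDeriv_succ', Nat.factorial_succ]
  push_cast
  field_simp

/-- For `n ≥ 2`, `0 ≤ r < 1` and a finite sequence `σ = (λ₁,…,λ_m)` in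
the unit disc with `1 ≤ m ≤ n` and `|λ_j| ≤ r` for all `j`, the differentiation operator
`D : K_{B_σ} → H²` satisfies `‖D‖ ≤ (n/(1-r))·(1 + r + 1/√n)`. -/
theorem stmt1 (n : ℕ) (hn : 2 ≤ n) (r : ℝ) (hr0 : 0 ≤ r) (hr1 : r < 1)
    (m : ℕ) (hm1 : 1 ≤ m) (hmn : m ≤ n) (l : Fin m → ℂ) (hl : ∀ j, ‖l j‖ ≤ r) :
    DNorm (fun z => ∏ j, blaschke (l j) z) ≤
      ((n : ℝ) / (1 - r)) * (1 + r + 1 / Real.sqrt n) := by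
  set L := List.ofFn l with hLdef
  have hL : ∀ x ∈ L, ‖x‖ ≤ r := by
    intro x hx
    obtain ⟨j, rfl⟩ := List.mem_ofFn.1 hx
    exact hl j
  have h1r : 0 < 1 - r := by linarith
  have hn0 : (0 : ℝ) < n := by positivity
  refine Real.sSup_le ?_ (by positivity)
  rintro _ ⟨f, ⟨hf, horth⟩, hf1, rfl⟩
  set a := SeqH2.mk (hcoeff f) hf.2 with ha
  have hnorm : ‖a‖ ≤ 1 := by
    have h := a.hasSum_norm_sq.tsum_eq
    simp only [ha, SeqH2.mk_apply] at h
    rwa [h2norm, h, Real.sqrt_sq (norm_nonneg _)] at hf1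
  have hinner : ∀ x, ⟪(L.map blaschkeOp).prod x, a⟫_ℂ = 0 := by
    intro x
    rw [← horth _ (memH2_seqEval x), h2inner, lp.inner_eq_tsum]
    refine tsum_congr fun k => ?_
    have heq : Set.EqOn (fun z => (∏ j, blaschke (l j) z) * seqEval x z)
        (seqEval ((L.map blaschkeOp).prod x)) (ball 0 1) := fun z hz => by
      rw [seqEval_prod_blaschkeOp L (fun y hy => (hL y hy).trans_lt hr1) x (by simpa using hz)]
      simp [hLdef, List.map_ofFn, List.prod_ofFn]
    rw [hcoeff_congr heq, hcoeff_seqEval]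
    rfl
  obtain ⟨a', ha', hle⟩ := exists_isSeqDeriv_norm_le hr1 L hL a hinner
  have hco : ∀ k, hcoeff (deriv f) k = a' k := fun k => by
    rw [hcoeff_deriv, ha' k, ha, SeqH2.mk_apply]
  simp only [h2norm, hco]
  rw [a'.hasSum_norm_sq.tsum_eq, Real.sqrt_sq (norm_nonneg _)]
  have hlen : (L.length : ℝ) ≤ n := by simpa [hLdef] using hmn
  calc ‖a'‖ ≤ (L.length * ((1 + r) / (1 - r)) + √L.length * (1 / (1 - r))) * ‖a‖ := hle
    _ ≤ (n * ((1 + r) / (1 - r)) + √n * (1 / (1 - r))) * 1 := by gcongr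
    _ = _ := by
      have hs : (n : ℝ) / √n = √n := Real.div_sqrt
      rw [mul_one]
      linear_combination -(1 / (1 - r)) * hs
end
end

section
/- Let n ≥ 2, 0 ≤ r < 1, b_r(z) = (r-z)/(1-rz), and e_n(z) = (1-r²)^{1/2}/(1-rz) · b_r(z)^{n-1}. Then ‖e_n'‖₂² ≥ (n/((1-r)(1+r)))² · (1 + 5r⁴ - 4r⁴/n - min(3/4, 2/n)). -/
open Complex Filter Finset MeasureTheory Metric

noncomputable section

/-- `f` is the sum on the closed unit disc of an absolutely summable power series with real
coefficients, whose squares have sum `q`. -/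
def HasRealNormSq (f : ℂ → ℂ) (q : ℝ) : Prop :=
  ∃ a : ℕ → ℝ, Summable (fun k => |a k|) ∧
    (∀ z : ℂ, ‖z‖ ≤ 1 → HasSum (fun k => (a k : ℂ) * z ^ k) (f z)) ∧
    HasSum (fun k => a k ^ 2) q

theorem HasSum.congr_terms {E : Type*} [AddCommMonoid E] [TopologicalSpace E] {f g : ℕ → E}
    {a b : E} (h : HasSum f a) (hfg : ∀ k, g k = f k) (hab : b = a) : HasSum g b := by
  rw [hab, funext hfg]
  exact h

theorem hcoeff_eq_of_hasSum {f : ℂ → ℂ} {a : ℕ → ℂ}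
    (h : ∀ᶠ z in nhds (0 : ℂ), HasSum (fun k => a k * z ^ k) (f z)) (k : ℕ) :
    hcoeff f k = a k := by
  have h1 : HasFPowerSeriesAt f (FormalMultilinearSeries.ofScalars ℂ a) 0 := by
    rw [hasFPowerSeriesAt_iff]
    filter_upwards [h] with z hz
    simpa [FormalMultilinearSeries.coeff_ofScalars, mul_comm] using hz
  have h2 := h1.analyticAt.hasFPowerSeriesAt.eq_formalMultilinearSeries h1
  have h3 := congrArg (fun p => FormalMultilinearSeries.coeff p k) h2
  simpa [FormalMultilinearSeries.coeff_ofScalars, hcoeff] using h3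

theorem eventually_norm_le_one : ∀ᶠ z in nhds (0 : ℂ), ‖z‖ ≤ 1 := by
  filter_upwards [ball_mem_nhds (0 : ℂ) one_pos] with z hz
  exact (mem_ball_zero_iff.mp hz).le

theorem HasRealNormSq.h2norm_sq {f : ℂ → ℂ} {q : ℝ} (h : HasRealNormSq f q) :
    h2norm f ^ 2 = q := by
  obtain ⟨a, -, hf, hq⟩ := h
  have hc : ∀ k, hcoeff f k = (a k : ℂ) :=
    hcoeff_eq_of_hasSum (eventually_norm_le_one.mono hf)
  have hs : ∑' k, ‖hcoeff f k‖ ^ 2 = q := by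
    simp only [hc, Complex.norm_real, Real.norm_eq_abs, sq_abs, hq.tsum_eq]
  rw [h2norm, hs, Real.sq_sqrt (hq.nonneg fun k => sq_nonneg (a k))]

theorem HasRealNormSq.congr {f g : ℂ → ℂ} {q : ℝ} (h : HasRealNormSq f q)
    (hfg : ∀ z : ℂ, ‖z‖ ≤ 1 → f z = g z) : HasRealNormSq g q := by
  obtain ⟨a, ha, hf, hq⟩ := h
  exact ⟨a, ha, fun z hz => hfg z hz ▸ hf z hz, hq⟩

theorem summable_mul_of_summable_abs {a b : ℕ → ℝ} (ha : Summable fun k => |a k|)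
    (hb : Summable fun k => |b k|) : Summable fun k => a k * b k := by
  refine Summable.of_norm_bounded (ha.mul_right (∑' j, |b j|)) fun k => ?_
  rw [Real.norm_eq_abs, abs_mul]
  gcongr
  exact hb.le_tsum k fun j _ => abs_nonneg _

theorem one_sub_mul_ne_zero {r : ℝ} (hr0 : 0 ≤ r) (hr1 : r < 1) {z : ℂ} (hz : ‖z‖ ≤ 1) :
    1 - (r : ℂ) * z ≠ 0 := by
  intro h
  have h1 : ‖(r : ℂ) * z‖ = 1 := by rw [← sub_eq_zero.mp h, norm_one]
  rw [norm_mul, Complex.norm_real, Real.norm_of_nonneg hr0] at h1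
  nlinarith [norm_nonneg z]

/-- Division by `1 - r z` preserves absolutely summable power series. -/
theorem exists_hasSum_div {r : ℝ} (hr0 : 0 ≤ r) (hr1 : r < 1) {f : ℂ → ℂ} {a : ℕ → ℝ}
    (ha : Summable fun k => |a k|)
    (hf : ∀ z : ℂ, ‖z‖ ≤ 1 → HasSum (fun k => (a k : ℂ) * z ^ k) (f z)) :
    ∃ h : ℕ → ℝ, Summable (fun k => |h k|) ∧
      ∀ z : ℂ, ‖z‖ ≤ 1 → HasSum (fun k => (h k : ℂ) * z ^ k) (f z / (1 - r * z)) := by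
  have hg : Summable fun k : ℕ => ‖r ^ k‖ := by
    simpa [abs_of_nonneg hr0] using summable_geometric_of_lt_one hr0 hr1
  have ha' : Summable fun k => ‖a k‖ := by simpa only [Real.norm_eq_abs] using ha
  have hsq := summable_norm_sum_mul_antidiagonal_of_summable_norm ha' hg
  simp only [Real.norm_eq_abs] at hsq
  refine ⟨fun k => ∑ p ∈ antidiagonal k, a p.1 * r ^ p.2, hsq, fun z hz => ?_⟩
  have hz' : ∀ k, ‖z ^ k‖ ≤ 1 := fun k => by
    rw [norm_pow]; exact pow_le_one₀ (norm_nonneg z) hz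
  have hrz : ‖(r : ℂ) * z‖ < 1 := by
    rw [norm_mul, Complex.norm_real, Real.norm_of_nonneg hr0]
    nlinarith [norm_nonneg z]
  have hA : Summable fun k => ‖(a k : ℂ) * z ^ k‖ := by
    refine Summable.of_nonneg_of_le (fun _ => norm_nonneg _) (fun k => ?_) ha
    rw [norm_mul, Complex.norm_real, Real.norm_eq_abs]
    exact mul_le_of_le_one_right (abs_nonneg _) (hz' k)
  have hB : Summable fun k : ℕ => ‖((r : ℂ) * z) ^ k‖ := by
    simpa only [norm_pow] using summable_geometric_of_lt_one (norm_nonneg _) hrz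
  have hsum := tsum_mul_tsum_eq_tsum_sum_antidiagonal_of_summable_norm hA hB
  have hsm := (summable_norm_sum_mul_antidiagonal_of_summable_norm hA hB).of_norm.hasSum
  rw [← hsum, (hf z hz).tsum_eq, tsum_geometric_of_norm_lt_one hrz, ← div_eq_mul_inv] at hsm
  refine hsm.congr_terms (fun k => ?_) rfl
  push_cast
  rw [sum_mul]
  refine sum_congr rfl fun p hp => ?_
  rw [← mem_antidiagonal.mp hp]
  ring

/-- The squared coefficient norm of `(α - β z) h`, in terms of that of `h`. -/
theorem hasRealNormSq_linear_mul (α β : ℝ) {f : ℂ → ℂ} {h : ℕ → ℝ}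
    (hh : Summable fun k => |h k|)
    (hf : ∀ z : ℂ, ‖z‖ ≤ 1 → HasSum (fun k => (h k : ℂ) * z ^ k) (f z)) :
    HasRealNormSq (fun z => (α - β * z) * f z)
      ((α ^ 2 + β ^ 2) * ∑' k, h k ^ 2 - 2 * α * β * ∑' k, h (k + 1) * h k) := by
  let T : ℕ → ℝ := fun k => Nat.casesOn (motive := fun _ => ℝ) k 0 h
  have hT : Summable fun k => |T k| := (summable_nat_add_iff 1).mp hh
  refine ⟨fun k => α * h k - β * T k, ?_, fun z hz => ?_, ?_⟩
  · exact ((hh.of_abs.mul_left α).sub (hT.of_abs.mul_left β)).abs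
  · have hTz : HasSum (fun k => (T k : ℂ) * z ^ k) (z * f z) := by
      rw [← hasSum_nat_add_iff' 1]
      refine ((hf z hz).mul_left z).congr_terms (fun k => ?_) ?_
      · simp only [T]; ring
      · simp [T]
    refine (((hf z hz).mul_left (α : ℂ)).sub (hTz.mul_left (β : ℂ))).congr_terms (fun k => ?_) ?_
    · push_cast; ring
    · ring
  · have h2 : HasSum (fun k => h k ^ 2) (∑' k, h k ^ 2) := by
      simpa only [sq] using (summable_mul_of_summable_abs hh hh).hasSum
    have hT2 : HasSum (fun k => T k ^ 2) (∑' k, h k ^ 2) := by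
      rw [← hasSum_nat_add_iff' 1]
      simpa [T] using h2
    have hhT : HasSum (fun k => h k * T k) (∑' k, h (k + 1) * h k) := by
      rw [← hasSum_nat_add_iff' 1]
      simpa [T] using
        (summable_mul_of_summable_abs ((summable_nat_add_iff 1).mpr hh) hh).hasSum
    refine (((h2.mul_left (α ^ 2)).add (hT2.mul_left (β ^ 2))).sub
      (hhT.mul_left (2 * α * β))).congr_terms (fun k => ?_) ?_
    · ring
    · ring

theorem HasRealNormSq.unique {f : ℂ → ℂ} {p q : ℝ} (hp : HasRealNormSq f p)
    (hq : HasRealNormSq f q) : p = q :=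
  hp.h2norm_sq.symm.trans hq.h2norm_sq

theorem blaschke_ofReal (r : ℝ) (z : ℂ) :
    blaschke (r : ℂ) z = (r - z) / (1 - r * z) := by
  simp [blaschke]

/-- Multiplication by a Blaschke factor is isometric. -/
theorem HasRealNormSq.blaschke_mul {r : ℝ} (hr0 : 0 ≤ r) (hr1 : r < 1) {f : ℂ → ℂ} {q : ℝ}
    (hf : HasRealNormSq f q) : HasRealNormSq (fun z => blaschke (r : ℂ) z * f z) q := by
  obtain ⟨a, ha, hfa, -⟩ := id hf
  obtain ⟨h, hh, hfh⟩ := exists_hasSum_div hr0 hr1 ha hfa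
  have h1 := (hasRealNormSq_linear_mul 1 r hh hfh).congr (g := f) fun z hz => by
    have := one_sub_mul_ne_zero hr0 hr1 hz
    push_cast
    field_simp
  have h2 := (hasRealNormSq_linear_mul r 1 hh hfh).congr
    (g := fun z => blaschke (r : ℂ) z * f z) fun z hz => by
      rw [blaschke_ofReal]
      push_cast
      ring
  convert h2 using 1
  rw [hf.unique h1]
  ring

theorem HasRealNormSq.blaschke_pow_mul {r : ℝ} (hr0 : 0 ≤ r) (hr1 : r < 1) {f : ℂ → ℂ}
    {q : ℝ} (hf : HasRealNormSq f q) (m : ℕ) :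
    HasRealNormSq (fun z => blaschke (r : ℂ) z ^ m * f z) q := by
  induction m with
  | zero => simpa using hf
  | succ m ih =>
    refine (ih.blaschke_mul hr0 hr1).congr fun z _ => ?_
    ring

/-- A multiple of the normalized Szegő kernel at `r` is orthogonal to every function vanishing
at `r`. -/
theorem HasRealNormSq.kernel_add {r : ℝ} (hr0 : 0 ≤ r) (hr1 : r < 1) {f : ℂ → ℂ} {q : ℝ}
    (hf : HasRealNormSq f q) (hfr : f r = 0) (c : ℝ) :
    HasRealNormSq (fun z => c * ((Real.sqrt (1 - r ^ 2) : ℂ) / (1 - r * z)) + f z)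
      (c ^ 2 + q) := by
  obtain ⟨a, ha, hfa, hq⟩ := hf
  have hpos : 0 < 1 - r ^ 2 := by nlinarith
  have hs := Real.sq_sqrt hpos.le
  set s := Real.sqrt (1 - r ^ 2)
  have hg := summable_geometric_of_lt_one hr0 hr1
  refine ⟨fun k => c * s * r ^ k + a k, ?_, fun z hz => ?_, ?_⟩
  · exact ((hg.mul_left (c * s)).add ha.of_abs).abs
  · have hrz : ‖(r : ℂ) * z‖ < 1 := by
      rw [norm_mul, Complex.norm_real, Real.norm_of_nonneg hr0]
      nlinarith [norm_nonneg z]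
    refine (((hasSum_geometric_of_norm_lt_one hrz).mul_left ((c : ℂ) * s)).add
      (hfa z hz)).congr_terms (fun k => ?_) ?_
    · push_cast; ring
    · ring
  · have hr : HasSum (fun k => a k * r ^ k) 0 := by
      have := hfa r (by rw [Complex.norm_real, Real.norm_of_nonneg hr0]; exact hr1.le)
      rw [hfr] at this
      refine Complex.hasSum_ofReal.mp ?_
      push_cast
      exact this
    have hgeo := hasSum_geometric_of_lt_one (sq_nonneg r) (by linarith : r ^ 2 < 1)
    refine (((hgeo.mul_left (c ^ 2 * s ^ 2)).add (hr.mul_left (2 * c * s))).add hq).congr_terms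
      (fun k => ?_) ?_
    · ring
    · rw [hs]; field_simp; ring

theorem deriv_mw {r : ℝ} (hr0 : 0 ≤ r) (hr1 : r < 1) (m : ℕ) {z : ℂ} (hz : ‖z‖ ≤ 1) :
    deriv (mw r (m + 2)) z =
      blaschke (r : ℂ) z ^ m * ((Real.sqrt (1 - r ^ 2) : ℂ) / (1 - r * z) *
        ((-(m + 1) + (2 * m + 3) * r * blaschke (r : ℂ) z
          - (m + 2) * r ^ 2 * blaschke (r : ℂ) z ^ 2) / (1 - r ^ 2))) := by
  have hu := one_sub_mul_ne_zero hr0 hr1 hz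
  have hr2 : (1 : ℂ) - r ^ 2 ≠ 0 := by
    have : 1 - r ^ 2 ≠ 0 := by nlinarith
    exact_mod_cast this
  have hd : HasDerivAt (fun z : ℂ => 1 - (r : ℂ) * z) (-r) z := by
    simpa using ((hasDerivAt_id z).const_mul (r : ℂ)).const_sub 1
  have hn : HasDerivAt (fun z : ℂ => (r : ℂ) - z) (-1) z := by
    simpa using (hasDerivAt_id z).const_sub (r : ℂ)
  have hb : HasDerivAt (blaschke (r : ℂ))
      ((-1 * (1 - r * z) - (r - z) * -r) / (1 - r * z) ^ 2) z := by
    rw [funext (blaschke_ofReal r)]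
    exact hn.div hd hu
  have hk := (hasDerivAt_const z (Real.sqrt (1 - r ^ 2) : ℂ)).div hd hu
  have hm : HasDerivAt (mw r (m + 2)) _ z := hk.mul (hb.pow (m + 1))
  rw [hm.deriv]
  simp only [Pi.div_apply, Nat.add_sub_cancel, show m + 2 - 1 = m + 1 from rfl, pow_succ]
  generalize hw : blaschke (r : ℂ) z ^ m = W
  rw [blaschke_ofReal]
  push_cast
  field_simp
  ring

theorem h2norm_deriv_mw_sq {r : ℝ} (hr0 : 0 ≤ r) (hr1 : r < 1) (m : ℕ) :
    h2norm (deriv (mw r (m + 2))) ^ 2 =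
      ((m + 1) ^ 2 + (2 * m + 3) ^ 2 * r ^ 2 + (m + 2) ^ 2 * r ^ 4) / (1 - r ^ 2) ^ 2 := by
  have hr2 : 1 - r ^ 2 ≠ 0 := by nlinarith
  have hbr : blaschke (r : ℂ) r = 0 := by simp [blaschke]
  have hzero : HasRealNormSq (fun _ => 0) 0 := ⟨fun _ => 0, by simp, by simp, by simp⟩
  have h0 := hzero.kernel_add hr0 hr1 rfl (-((m + 2) * r ^ 2) / (1 - r ^ 2))
  have h1 := (h0.blaschke_mul hr0 hr1).kernel_add hr0 hr1 (by simp [hbr])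
    ((2 * m + 3) * r / (1 - r ^ 2))
  have h2 := (h1.blaschke_mul hr0 hr1).kernel_add hr0 hr1 (by simp [hbr])
    (-(m + 1) / (1 - r ^ 2))
  have h3 := (h2.blaschke_pow_mul hr0 hr1 m).congr (g := deriv (mw r (m + 2))) fun z hz => by
    rw [deriv_mw hr0 hr1 m hz]
    push_cast
    ring
  rw [h3.h2norm_sq]
  field_simp
  ring

/-- For `n ≥ 2`, `0 ≤ r < 1` and the Malmquist–Walsh function
`e_n(z) = (1-r²)^{1/2}/(1-rz)·b_r(z)^{n-1}`, one has
`‖e_n'‖₂² ≥ (n/((1-r)(1+r)))²·(1 + 5r⁴ - 4r⁴/n - min(3/4, 2/n))`. -/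
theorem stmt7 (n : ℕ) (hn : 2 ≤ n) (r : ℝ) (hr0 : 0 ≤ r) (hr1 : r < 1) :
    h2norm (deriv (mw r n)) ^ 2 ≥
      ((n : ℝ) / ((1 - r) * (1 + r))) ^ 2 *
        (1 + 5 * r ^ 4 - 4 * r ^ 4 / (n : ℝ) - min (3 / 4 : ℝ) (2 / (n : ℝ))) := by
  obtain ⟨m, rfl⟩ := Nat.exists_eq_add_of_le' hn
  rw [h2norm_deriv_mw_sq hr0 hr1 m]
  push_cast
  have hm : (0 : ℝ) ≤ m := m.cast_nonneg
  have hr2 : 0 < 1 - r ^ 2 := by nlinarith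
  have hmin : 2 / ((m : ℝ) + 2) - 1 / ((m : ℝ) + 2) ^ 2 ≤ min (3 / 4) (2 / ((m : ℝ) + 2)) := by
    refine le_min ?_ (sub_le_self _ (by positivity))
    rw [← sub_nonneg]
    have : 3 / 4 - (2 / ((m : ℝ) + 2) - 1 / ((m : ℝ) + 2) ^ 2) =
        m * (3 * m + 4) / (4 * (m + 2) ^ 2) := by
      field_simp
      ring
    rw [this]
    positivity
  rw [show (1 - r) * (1 + r) = 1 - r ^ 2 by ring, div_pow, ge_iff_le, div_mul_eq_mul_div]
  gcongr
  calc ((m : ℝ) + 2) ^ 2 * (1 + 5 * r ^ 4 - 4 * r ^ 4 / ((m : ℝ) + 2)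
        - min (3 / 4) (2 / ((m : ℝ) + 2)))
      ≤ ((m : ℝ) + 2) ^ 2 * (1 + 5 * r ^ 4 - 4 * r ^ 4 / ((m : ℝ) + 2)
        - (2 / ((m : ℝ) + 2) - 1 / ((m : ℝ) + 2) ^ 2)) := by gcongr
    _ = ((m : ℝ) + 1) ^ 2 + (2 * m + 3) ^ 2 * r ^ 2 + (m + 2) ^ 2 * r ^ 4
        - (r ^ 2 + 4 * (m + 1) * (m + 2) * (r ^ 2 * (1 - r ^ 2))) := by
      field_simp
      ring
    _ ≤ _ := sub_le_self _ (by positivity)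
end
end
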